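/- Let Y be a regular topological space and let X be a Souslin-F set in a regular completely Baire space Z, such that X (with the subspace topology) is a perfectly paracompact space satisfying the first axiom of countability. If f : X → Y is a Σ⁰₂-measurable mapping which is not piecewise continuous, then f is not Δ⁰₂-measurable; that is, there is an open set U ⊆ Y such that f⁻¹(U) is not simultaneously an Fσ set and a Gδ set in X. -/

import Mathlib

open Set Topology

/-- A set is Fσ if it is a countable union of closed sets. -/
def IsFsigma {X : Type*} [TopologicalSpace X] (s : Set X) : Prop :=
  ∃ C : ℕ → Set X, (∀ n, IsClosed (C n)) ∧ s = ⋃ n, C n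

/-- A map is piecewise continuous if its domain is covered by countably many
closed sets on each of which the map is continuous. -/
def PiecewiseContinuous {X Y : Type*} [TopologicalSpace X] [TopologicalSpace Y]
    (f : X → Y) : Prop :=
  ∃ C : ℕ → Set X, (∀ n, IsClosed (C n)) ∧ (⋃ n, C n) = Set.univ ∧
    ∀ n, ContinuousOn f (C n)

/-- A map is Δ⁰₂-measurable if preimages of open sets are both Fσ and Gδ. -/
def Delta02Measurable {X Y : Type*} [TopologicalSpace X] [TopologicalSpace Y]
    (f : X → Y) : Prop :=
  ∀ U : Set Y, IsOpen U → IsFsigma (f ⁻¹' U) ∧ IsGδ (f ⁻¹' U)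

/-- A map is Σ⁰₂-measurable if preimages of open sets are Fσ. -/
def Sigma02Measurable {X Y : Type*} [TopologicalSpace X] [TopologicalSpace Y]
    (f : X → Y) : Prop :=
  ∀ U : Set Y, IsOpen U → IsFsigma (f ⁻¹' U)

/-- X ⊆ Z is Souslin-F in Z: the result of the A-operation applied to a system
of closed subsets of Z, where `(List.range n).map α` encodes α|n. -/
def SouslinF {Z : Type*} [TopologicalSpace Z] (X : Set Z) : Prop :=
  ∃ F : List ℕ → Set Z, (∀ s, IsClosed (F s)) ∧
    X = ⋃ α : ℕ → ℕ, ⋂ n : ℕ, F ((List.range n).map α)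

/-- A space is completely Baire if every closed subspace is a Baire space. -/
def CompletelyBaire (Z : Type*) [TopologicalSpace Z] : Prop :=
  ∀ s : Set Z, IsClosed s → BaireSpace s

/-- Membership in the σ-ideal I_f: A is contained in an Fσ set F such that
the restriction f|F is piecewise continuous. -/
def MemIf {X Y : Type*} [TopologicalSpace X] [TopologicalSpace Y]
    (f : X → Y) (A : Set X) : Prop :=
  ∃ F : Set X, IsFsigma F ∧ A ⊆ F ∧ PiecewiseContinuous (F.restrict f)

/-- A^f = f⁻¹(Y \ cl(A)). -/
def Af {X Y : Type*} [TopologicalSpace Y] (f : X → Y) (A : Set Y) : Set X :=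
  f ⁻¹' (closure A)ᶜ

/-- The pair (x, X′) is f-irreducible outside A: for every open neighborhood V
of x, A^f ∩ X′ ∩ V ∉ I_f. -/
def IrredOutside {X Y : Type*} [TopologicalSpace X] [TopologicalSpace Y]
    (f : X → Y) (x : X) (X' : Set X) (A : Set Y) : Prop :=
  ∀ V : Set X, IsOpen V → x ∈ V → ¬ MemIf f (Af f A ∩ X' ∩ V)

theorem exists_isOpen_mem_closure_subset {Y : Type*} [TopologicalSpace Y] [RegularSpace Y]
    {y : Y} {O : Set Y} (hO : O ∈ 𝓝 y) : ∃ W, IsOpen W ∧ y ∈ W ∧ closure W ⊆ O := by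
  obtain ⟨K, ⟨hK, hKc⟩, hKO⟩ := (closed_nhds_basis y).mem_iff.1 hO
  exact ⟨interior K, isOpen_interior, mem_interior_iff_mem_nhds.2 hK,
    (closure_minimal interior_subset hKc).trans hKO⟩

theorem Af_anti {X Y : Type*} [TopologicalSpace Y] {f : X → Y} {A B : Set Y} (h : A ⊆ B) :
    Af f B ⊆ Af f A :=
  preimage_mono (compl_subset_compl.2 (closure_mono h))

theorem Af_union {X Y : Type*} [TopologicalSpace Y] {f : X → Y} {A B : Set Y} :
    Af f (A ∪ B) = Af f A ∩ Af f B := by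
  simp [Af, closure_union, compl_union]

theorem notMem_Af {X Y : Type*} [TopologicalSpace Y] {f : X → Y} {A : Set Y} {x : X} (h : f x ∈ A) :
    x ∉ Af f A := fun hx => hx (subset_closure h)

section PiecewiseIdeal

variable {X Y : Type*} [TopologicalSpace X] [TopologicalSpace Y] {f : X → Y}

/-- A set belongs to `I_f` as soon as it is covered by a countable family of closed sets on each of
which `f` is continuous. -/
theorem memIf_of_countable_cover {ι : Type*} [Countable ι] {A : Set X} (C : ι → Set X)
    (hC : ∀ i, IsClosed (C i)) (hA : A ⊆ ⋃ i, C i) (hf : ∀ i, ContinuousOn f (C i)) :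
    MemIf f A := by
  rcases isEmpty_or_nonempty ι with h | h
  · have hA' : A ⊆ ∅ := by simpa using hA
    exact ⟨∅, ⟨fun _ => ∅, fun _ => isClosed_empty, by simp⟩, hA',
      fun _ => univ, fun _ => isClosed_univ, iUnion_const _,
      fun _ => (continuous_of_const fun x => x.2.elim).continuousOn⟩
  · obtain ⟨e, he⟩ := exists_surjective_nat ι
    have hU : ⋃ i, C i = ⋃ n, C (e n) := (he.iUnion_comp C).symm
    refine ⟨⋃ i, C i, ⟨fun n => C (e n), fun n => hC _, hU⟩, hA,
      fun n => Subtype.val ⁻¹' C (e n), fun n => (hC _).preimage continuous_subtype_val, ?_,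
      fun n => ?_⟩
    · rw [← preimage_iUnion, ← hU]
      exact Subtype.coe_preimage_self _
    · exact (hf (e n)).comp continuous_subtype_val.continuousOn fun x hx => hx

/-- Membership in `I_f` amounts to being covered by countably many closed sets on each of which
`f` is continuous. -/
theorem memIf_iff_exists_closed_cover {A : Set X} :
    MemIf f A ↔ ∃ C : ℕ → Set X, (∀ n, IsClosed (C n)) ∧ A ⊆ ⋃ n, C n ∧
      ∀ n, ContinuousOn f (C n) := by
  refine ⟨?_, fun ⟨C, hC, hA, hf⟩ => memIf_of_countable_cover C hC hA hf⟩
  rintro ⟨F, ⟨D, hD, rfl⟩, hA, E, hE, hEU, hEf⟩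
  choose E' hE' hEE' using fun n => isClosed_induced_iff.1 (hE n)
  refine ⟨fun n => D n.unpair.1 ∩ E' n.unpair.2, fun n => (hD _).inter (hE' _), fun x hx => ?_,
    fun n => ?_⟩
  · obtain ⟨i, hi⟩ := mem_iUnion.1 (hA hx)
    have hx' : (⟨x, hA hx⟩ : ↥(⋃ n, D n)) ∈ ⋃ n, E n := hEU ▸ mem_univ _
    obtain ⟨j, hj⟩ := mem_iUnion.1 hx'
    rw [← hEE' j] at hj
    exact mem_iUnion.2 ⟨Nat.pair i j, by simpa using ⟨hi, hj⟩⟩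
  · refine (Topology.IsInducing.subtypeVal.continuousOn_image_iff.2 (hEf n.unpair.2)).mono ?_
    exact fun x hx => ⟨⟨x, mem_iUnion.2 ⟨_, hx.1⟩⟩, hEE' n.unpair.2 ▸ hx.2, rfl⟩

theorem MemIf.mono {A B : Set X} (hB : MemIf f B) (h : A ⊆ B) : MemIf f A :=
  let ⟨F, hF, hBF, hpc⟩ := hB
  ⟨F, hF, h.trans hBF, hpc⟩

theorem MemIf.iUnion {ι : Type*} [Countable ι] {A : ι → Set X} (h : ∀ i, MemIf f (A i)) :
    MemIf f (⋃ i, A i) := by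
  choose C hC hA hf using fun i => memIf_iff_exists_closed_cover.1 (h i)
  refine memIf_of_countable_cover (fun p : ι × ℕ => C p.1 p.2) (fun p => hC _ _) ?_
    fun p => hf _ _
  refine iUnion_subset fun i => (hA i).trans (iUnion_subset fun n => ?_)
  exact subset_iUnion (fun p : ι × ℕ => C p.1 p.2) (i, n)

theorem MemIf.union {A B : Set X} (hA : MemIf f A) (hB : MemIf f B) : MemIf f (A ∪ B) := by
  rw [union_eq_iUnion]
  exact MemIf.iUnion (Bool.forall_bool.2 ⟨hB, hA⟩)

/-- If the union of a countable family covers `A ∉ I_f`, then the trace of `A` on some member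
is not in `I_f`. -/
theorem exists_not_memIf_inter {ι : Type*} [Countable ι] {A : Set X} {B : ι → Set X}
    (hA : ¬ MemIf f A) (h : A ⊆ ⋃ i, B i) : ∃ i, ¬ MemIf f (B i ∩ A) := by
  by_contra! H
  refine hA ((MemIf.iUnion H).mono ?_)
  rw [← iUnion_inter]
  exact subset_inter h Subset.rfl

theorem not_memIf_univ (h : ¬ PiecewiseContinuous f) : ¬ MemIf f univ := fun hm =>
  let ⟨C, hC, hU, hf⟩ := memIf_iff_exists_closed_cover.1 hm
  h ⟨C, hC, univ_subset_iff.1 hU, hf⟩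

theorem memIf_empty : MemIf f ∅ :=
  memIf_of_countable_cover (fun n : Empty => n.elim) (fun n => n.elim) (empty_subset _)
    fun n => n.elim

/-- In a regular paracompact space, a set which is locally in `I_f` is in `I_f`. -/
theorem memIf_of_locally [RegularSpace X] [ParacompactSpace X] {A : Set X}
    (h : ∀ x, ∃ V, IsOpen V ∧ x ∈ V ∧ MemIf f (V ∩ A)) : MemIf f A := by
  choose V hVo hxV hV using h
  choose W hWo hxW hWV using fun x => exists_isOpen_mem_closure_subset ((hVo x).mem_nhds (hxV x))
  obtain ⟨w, -, hwU, hwf, hwW⟩ := precise_refinement W hWo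
    (eq_univ_of_forall fun x => mem_iUnion.2 ⟨x, hxW x⟩)
  choose C hC hCA hCf using fun x => memIf_iff_exists_closed_cover.1 (hV x)
  have hfin : ∀ n, LocallyFinite fun x => closure (w x) ∩ C x n := fun n =>
    hwf.closure.subset fun x => inter_subset_left
  have hcl : ∀ n x, IsClosed (closure (w x) ∩ C x n) := fun n x => isClosed_closure.inter (hC x n)
  refine memIf_of_countable_cover (fun n => ⋃ x, closure (w x) ∩ C x n)
    (fun n => (hfin n).isClosed_iUnion (hcl n)) (fun a ha => ?_) fun n =>
    (hfin n).continuousOn_iUnion (hcl n) fun x => (hCf x n).mono inter_subset_right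
  obtain ⟨x, hx⟩ := mem_iUnion.1 (hwU ▸ mem_univ a : a ∈ ⋃ x, w x)
  have hx' := subset_closure hx
  obtain ⟨n, hn⟩ := mem_iUnion.1 (hCA x ⟨hWV x (closure_mono (hwW x) hx'), ha⟩)
  exact mem_iUnion.2 ⟨n, mem_iUnion.2 ⟨x, hx', hn⟩⟩

/-- In a regular paracompact space whose closed sets are `Gδ`, the part of `S` near which `S` is
locally in `I_f` is itself in `I_f`. -/
theorem memIf_inter_of_isOpen [RegularSpace X] [ParacompactSpace X]
    (hGδ : ∀ s : Set X, IsClosed s → IsGδ s) {S G : Set X} (hG : IsOpen G)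
    (h : ∀ x ∈ G, ∃ V, IsOpen V ∧ x ∈ V ∧ MemIf f (V ∩ S)) : MemIf f (G ∩ S) := by
  obtain ⟨D, hD, hDG⟩ := isGδ_iff_eq_iInter_nat.1 (hGδ _ hG.isClosed_compl)
  have hG' : G = ⋃ n, (D n)ᶜ := by rw [← compl_iInter, ← hDG, compl_compl]
  rw [hG', iUnion_inter]
  refine MemIf.iUnion fun n => memIf_of_locally fun x => ?_
  by_cases hx : x ∈ D n
  · exact ⟨D n, hD n, hx, memIf_empty.mono fun y hy => hy.2.1 hy.1⟩
  · obtain ⟨V, hV, hxV, hm⟩ := h x (hG' ▸ mem_iUnion.2 ⟨n, hx⟩)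
    exact ⟨V, hV, hxV, hm.mono fun y hy => ⟨hy.1, hy.2.2⟩⟩

theorem IrredOutside.anti {x : X} {S : Set X} {A B : Set Y} (h : IrredOutside f x S B)
    (hAB : A ⊆ B) : IrredOutside f x S A := fun V hV hxV hm =>
  h V hV hxV (hm.mono (inter_subset_inter_left _ (inter_subset_inter_left _ (Af_anti hAB))))

theorem IrredOutside.union_left {x : X} {S : Set X} {A U : Set Y} (h : IrredOutside f x S U)
    (hS : S ⊆ Af f A) : IrredOutside f x S (A ∪ U) := fun V hV hxV hm =>
  h V hV hxV (hm.mono fun _ hy => ⟨⟨Af_union (f := f) ▸ ⟨hS hy.1.2, hy.1.1⟩, hy.1.2⟩, hy.2⟩)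

/-- Of two sets with disjoint closures, at least one can be added to a set outside of which a pair
is irreducible. -/
theorem IrredOutside.union_or_union {x : X} {S : Set X} {A U U' : Set Y}
    (h : IrredOutside f x S A) (hd : Disjoint (closure U) (closure U')) :
    IrredOutside f x S (A ∪ U) ∨ IrredOutside f x S (A ∪ U') := by
  by_contra! H
  simp only [IrredOutside, not_forall, not_not] at H
  obtain ⟨⟨V, hV, hxV, hm⟩, ⟨V', hV', hxV', hm'⟩⟩ := H
  refine h (V ∩ V') (hV.inter hV') ⟨hxV, hxV'⟩ ((hm.union hm').mono ?_)
  rintro y ⟨⟨hyA, hyS⟩, hyV, hyV'⟩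
  rw [Af_union, Af_union]
  by_cases hy : f y ∈ closure U
  · exact Or.inr ⟨⟨⟨hyA, disjoint_left.1 hd hy⟩, hyS⟩, hyV'⟩
  · exact Or.inl ⟨⟨⟨hyA, hy⟩, hyS⟩, hyV⟩

/-- Every set outside `I_f` has an irreducible pair. -/
theorem exists_irredOutside [RegularSpace X] [ParacompactSpace X] [RegularSpace Y]
    (hGδ : ∀ s : Set X, IsClosed s → IsGδ s) {S : Set X} (hS : ¬ MemIf f S) :
    ∃ x ∈ closure S, ∃ U, IsOpen U ∧ f x ∈ U ∧ IrredOutside f x S U := by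
  by_contra! H
  set G : Set X := ⋃₀ {V | IsOpen V ∧ MemIf f (V ∩ S)}
  have hG : IsOpen G := isOpen_sUnion fun V hV => hV.1
  have hGS : MemIf f (G ∩ S) := memIf_inter_of_isOpen hGδ hG fun x ⟨V, hV, hx⟩ =>
    ⟨V, hV.1, hx, hV.2⟩
  have hker : ∀ x ∈ Gᶜ, ∀ V, IsOpen V → x ∈ V → ¬ MemIf f (V ∩ S) := fun x hx V hV hxV hm =>
    hx ⟨V, ⟨hV, hm⟩, hxV⟩
  have hcl : Gᶜ ⊆ closure S := fun x hx => mem_closure_iff.2 fun V hV hxV => by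
    by_contra hne
    exact hker x hx V hV hxV (not_nonempty_iff_eq_empty.1 hne ▸ memIf_empty)
  have hsmall : ∀ x ∈ Gᶜ, ∀ U, IsOpen U → f x ∈ U →
      ∃ V, IsOpen V ∧ x ∈ V ∧ MemIf f (Af f U ∩ S ∩ V) := fun x hx U hU hxU => by
    simpa only [IrredOutside, not_forall, not_not, exists_prop] using H x (hcl hx) U hU hxU
  have hcont : ContinuousOn f Gᶜ := fun x hx => by
    refine Filter.tendsto_def.2 fun O hO => ?_
    obtain ⟨W, hWo, hxW, hWO⟩ := exists_isOpen_mem_closure_subset hO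
    obtain ⟨V, hVo, hxV, hVm⟩ := hsmall x hx W hWo hxW
    refine mem_nhdsWithin.2 ⟨V, hVo, hxV, fun x' hx' => hWO ?_⟩
    by_contra hx'W
    obtain ⟨W', hWo', hxW', hWO'⟩ :=
      exists_isOpen_mem_closure_subset (isClosed_closure.isOpen_compl.mem_nhds hx'W)
    obtain ⟨V', hVo', hxV', hVm'⟩ := hsmall x' hx'.2 W' hWo' hxW'
    refine hker x' hx'.2 (V ∩ V') (hVo.inter hVo') ⟨hx'.1, hxV'⟩ ((hVm.union hVm').mono ?_)
    rintro y ⟨⟨hyV, hyV'⟩, hyS⟩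
    by_cases hy : f y ∈ closure W
    · exact Or.inr ⟨⟨fun hy' => hWO' hy' hy, hyS⟩, hyV'⟩
    · exact Or.inl ⟨⟨hy, hyS⟩, hyV⟩
  refine hS ((hGS.union (memIf_of_countable_cover (fun _ : Unit => Gᶜ)
    (fun _ => hG.isClosed_compl) (subset_iUnion (fun _ : Unit => Gᶜ) ())
    fun _ => hcont)).mono fun x hx => ?_)
  by_cases hxG : x ∈ G
  · exact Or.inl ⟨hxG, hx⟩
  · exact Or.inr hxG

/-- A set outside `I_f` lying in `A^f` has a part outside `I_f` whose closure lies in `A^f`. -/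
theorem exists_closure_subset_Af (hf : Sigma02Measurable f) {A : Set Y} {S : Set X}
    (hS : ¬ MemIf f (Af f A ∩ S)) :
    ∃ T ⊆ S, ¬ MemIf f T ∧ closure T ⊆ Af f A := by
  obtain ⟨C, hC, hCA⟩ := hf (closure A)ᶜ isClosed_closure.isOpen_compl
  obtain ⟨n, hn⟩ := exists_not_memIf_inter (B := C) hS fun x hx => hCA ▸ hx.1
  refine ⟨_, inter_subset_right.trans inter_subset_right, hn,
    (closure_minimal inter_subset_left (hC n)).trans ?_⟩
  rw [Af, hCA]
  exact subset_iUnion C n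

/-- Any set outside `I_f` whose closure lies in `A^f` has a part with an irreducible pair such that
enlarging `A` keeps finitely many given pairs irreducible. -/
theorem exists_irredOutside_union [RegularSpace X] [ParacompactSpace X] [RegularSpace Y]
    (hGδ : ∀ s : Set X, IsClosed s → IsGδ s) (hf : Sigma02Measurable f)
    {ι : Type*} (I : Finset ι) (y : ι → X) (T : ι → Set X) (A : Set Y)
    (hI : ∀ i ∈ I, IrredOutside f (y i) (T i) A) (B : Set Y) (S : Set X)
    (hS : ¬ MemIf f S) (hSB : closure S ⊆ Af f B) :
    ∃ S' ⊆ S, ∃ x ∈ closure S', ∃ U, IsOpen U ∧ f x ∈ U ∧ Disjoint (closure U) (closure B) ∧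
      IrredOutside f x S' U ∧ ∀ i ∈ I, IrredOutside f (y i) (T i) (A ∪ U) := by
  classical
  induction I using Finset.induction_on generalizing B S with
  | empty =>
    obtain ⟨x, hx, U, hU, hxU, hirr⟩ := exists_irredOutside hGδ hS
    obtain ⟨W, hW, hxW, hWU⟩ := exists_isOpen_mem_closure_subset
      ((hU.inter isClosed_closure.isOpen_compl).mem_nhds ⟨hxU, hSB hx⟩)
    exact ⟨S, Subset.rfl, x, hx, W, hW, hxW, disjoint_left.2 fun z hz => (hWU hz).2,
      hirr.anti fun z hz => (hWU (subset_closure hz)).1, by simp⟩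
  | insert a I ha ih =>
    replace ih := ih fun i hi => hI i (Finset.mem_insert_of_mem hi)
    obtain ⟨S₁, hS₁, x₁, hx₁, U₁, hU₁, hxU₁, hd₁, hirr₁, hI₁⟩ := ih B S hS hSB
    obtain ⟨R, hRS, hR, hRU⟩ := exists_closure_subset_Af hf (A := U₁) (S := S₁)
      (by simpa using hirr₁ univ isOpen_univ (mem_univ _))
    have hRB : closure R ⊆ Af f (B ∪ U₁) :=
      Af_union (f := f) ▸ subset_inter ((closure_mono (hRS.trans hS₁)).trans hSB) hRU
    obtain ⟨S₂, hS₂, x₂, hx₂, U₂, hU₂, hxU₂, hd₂, hirr₂, hI₂⟩ := ih (B ∪ U₁) R hR hRB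
    rw [closure_union, disjoint_union_right] at hd₂
    rcases (hI a (Finset.mem_insert_self a I)).union_or_union hd₂.2.symm with h | h
    · exact ⟨S₁, hS₁, x₁, hx₁, U₁, hU₁, hxU₁, hd₁, hirr₁, Finset.forall_mem_insert _ _ _ |>.2
        ⟨h, hI₁⟩⟩
    · exact ⟨S₂, hS₂.trans (hRS.trans hS₁), x₂, hx₂, U₂, hU₂, hxU₂, hd₂.1, hirr₂,
        Finset.forall_mem_insert _ _ _ |>.2 ⟨h, hI₂⟩⟩

end PiecewiseIdeal

/-- The set of points obtained from the Souslin scheme `F` along the branches which agree with `α`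
in the first `n` places. -/
def souslinPart {Z : Type*} (F : List ℕ → Set Z) (n : ℕ) (α : ℕ → ℕ) : Set Z :=
  {z | ∃ β : ℕ → ℕ, (∀ k < n, β k = α k) ∧ ∀ j, z ∈ F ((List.range j).map β)}

theorem map_range_congr {α β : ℕ → ℕ} {n : ℕ} (h : ∀ k < n, β k = α k) :
    (List.range n).map β = (List.range n).map α :=
  List.map_congr_left fun k hk => h k (List.mem_range.1 hk)

theorem souslinPart_subset {Z : Type*} (F : List ℕ → Set Z) {n j : ℕ} (hj : j ≤ n) (α : ℕ → ℕ) :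
    souslinPart F n α ⊆ F ((List.range j).map α) := by
  rintro z ⟨β, hβ, hz⟩
  rw [← map_range_congr fun k hk => hβ k (hk.trans_le hj)]
  exact hz j

theorem souslinPart_subset_iUnion {Z : Type*} (F : List ℕ → Set Z) (n : ℕ) (α : ℕ → ℕ) :
    souslinPart F n α ⊆ ⋃ k, souslinPart F (n + 1) (Function.update α n k) := by
  rintro z ⟨β, hβ, hz⟩
  refine mem_iUnion.2 ⟨β n, β, fun k hk => ?_, hz⟩
  rcases Nat.lt_succ_iff_lt_or_eq.1 hk with h | rfl
  · rw [Function.update_of_ne h.ne, hβ k h]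
  · rw [Function.update_self]

/-- A set outside `I_f` lying in a part of a Souslin set has a piece outside `I_f` lying in
a part determined by a longer initial segment. -/
theorem exists_subset_souslinPart {X Y Z : Type*} [TopologicalSpace X] [TopologicalSpace Y]
    {f : X → Y} (F : List ℕ → Set Z) (g : X → Z) {n t : ℕ} (hnt : n ≤ t) {α : ℕ → ℕ} {S : Set X}
    (hS : ¬ MemIf f S) (hSα : S ⊆ g ⁻¹' souslinPart F n α) :
    ∃ T ⊆ S, ¬ MemIf f T ∧ ∃ β : ℕ → ℕ, (∀ k < n, β k = α k) ∧ T ⊆ g ⁻¹' souslinPart F t β := by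
  induction t, hnt using Nat.le_induction with
  | base => exact ⟨S, Subset.rfl, hS, α, fun _ _ => rfl, hSα⟩
  | succ t hnt ih =>
    obtain ⟨T, hTS, hT, β, hβ, hTβ⟩ := ih
    obtain ⟨k, hk⟩ := exists_not_memIf_inter
      (B := fun k => g ⁻¹' souslinPart F (t + 1) (Function.update β t k)) hT fun x hx => by
        simpa using souslinPart_subset_iUnion F t β (hTβ hx)
    refine ⟨_, inter_subset_right.trans hTS, hk, _, fun j hj => ?_, inter_subset_left⟩
    rw [Function.update_of_ne (hj.trans_le hnt).ne, hβ j hj]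

/-- Strong dependent choice: a sequence can be built term by term when each admissible finite
initial segment admits a next term. -/
theorem exists_seq_of_forall_lt {N : Type*} [Nonempty N] (R : ℕ → (ℕ → N) → N → Prop)
    (hR : ∀ t d d' n, (∀ i < t, d i = d' i) → R t d n → R t d' n)
    (h : ∀ t d, (∀ i < t, R i d (d i)) → ∃ n, R t d n) : ∃ d, ∀ t, R t d (d t) := by
  classical
  let next : ℕ → (ℕ → N) → N := fun t d => Classical.epsilon (R t d)
  let g : ∀ t, (∀ i < t, N) → N := fun t u =>
    next t fun i => if hi : i < t then u i hi else Classical.arbitrary N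
  let d : ℕ → N := fun t => Nat.strongRec g t
  have hd : ∀ t, d t = next t fun i => if i < t then d i else Classical.arbitrary N := fun t => by
    simp only [d]
    rw [Nat.strongRec_eq]
    simp [g]
  refine ⟨d, fun t => ?_⟩
  induction t using Nat.strong_induction_on with
  | _ t ih =>
    set d' : ℕ → N := fun i => if i < t then d i else Classical.arbitrary N
    have hdd' : ∀ i < t, d i = d' i := fun i hi => (if_pos hi).symm
    have hn : ∃ n, R t d' n := h t d' fun i hi =>
      hdd' i hi ▸ hR i d d' _ (fun j hj => hdd' j (hj.trans hi)) (ih i hi)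
    refine hR t d' d _ (fun i hi => (hdd' i hi).symm) ?_
    rw [hd t]
    exact Classical.epsilon_spec hn

/-- A node of the construction: a point, a set of which it is a limit, an open set of values,
a neighbourhood of the point in the ambient space and a branch of the Souslin scheme. -/
structure SchemeNode {Z : Type*} (X : Set Z) (Y : Type*) where
  point : X
  piece : Set X
  value : Set Y
  nhd : Set Z
  code : ℕ → ℕ

/-- The index of the node near which the node of index `t` is placed. -/
def parent (t : ℕ) : ℕ := (t - 1).unpair.1

theorem parent_lt {t : ℕ} (ht : 0 < t) : parent t < t :=
  (Nat.unpair_left_le (t - 1)).trans_lt (Nat.sub_lt ht one_pos)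

theorem parent_pair_succ (i k : ℕ) : parent (Nat.pair i k + 1) = i := by
  simp [parent]

/-- The conditions under which `n` may follow the first `t` nodes of the sequence `d`. -/
structure SchemeNode.Follows {Z Y : Type*} [TopologicalSpace Z] [TopologicalSpace Y] {X : Set Z}
    (f : X → Y) (F : List ℕ → Set Z) (B : X → ℕ → Set X) (t : ℕ) (d : ℕ → SchemeNode X Y)
    (n : SchemeNode X Y) : Prop where
  isOpen_value : IsOpen n.value
  map_mem_value : f n.point ∈ n.value
  isOpen_nhd : IsOpen n.nhd
  point_mem_nhd : (n.point : Z) ∈ n.nhd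
  point_mem_closure : n.point ∈ closure n.piece
  piece_subset : n.piece ⊆ Subtype.val ⁻¹' souslinPart F t n.code
  closure_piece_subset : closure n.piece ⊆ Af f (⋃ j < t, (d j).value)
  notMem_closure_nhd : ∀ m < t, ((d m).point : Z) ∉ closure n.nhd
  disjoint_or_mem : ∀ m < t, Disjoint n.nhd (d m).nhd ∨
    (n.point : Z) ∈ (d m).nhd ∧ n.piece ⊆ (d m).piece ∧ ∀ k < m, n.code k = (d m).code k
  irred : ∀ i < t, IrredOutside f (d i).point (d i).piece ((⋃ j < t, (d j).value) ∪ n.value)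
  irred_self : IrredOutside f n.point n.piece ((⋃ j < t, (d j).value) ∪ n.value)
  mem_basis : 0 < t → n.point ∈ B (d (parent t)).point t

section Scheme

variable {Z Y : Type*} [TopologicalSpace Z] [TopologicalSpace Y] {X : Set Z} {f : X → Y}
  {F : List ℕ → Set Z} {B : X → ℕ → Set X}

theorem SchemeNode.Follows.congr {t : ℕ} {d d' : ℕ → SchemeNode X Y} {n : SchemeNode X Y}
    (h : n.Follows f F B t d) (hd : ∀ i < t, d i = d' i) : n.Follows f F B t d' := by
  have hU : ⋃ j < t, (d' j).value = ⋃ j < t, (d j).value :=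
    iUnion₂_congr fun j hj => by rw [hd j hj]
  refine ⟨h.isOpen_value, h.map_mem_value, h.isOpen_nhd, h.point_mem_nhd, h.point_mem_closure,
    h.piece_subset, hU ▸ h.closure_piece_subset, fun m hm => hd m hm ▸ h.notMem_closure_nhd m hm,
    fun m hm => hd m hm ▸ h.disjoint_or_mem m hm, fun i hi => ?_, hU ▸ h.irred_self, fun ht => ?_⟩
  · rw [hU, ← hd i hi]
    exact h.irred i hi
  · rw [← hd _ (parent_lt ht)]
    exact h.mem_basis ht

/-- A point of the scheme either stays away from a neighbourhood of the scheme, or lies in it and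
then its node refines the node of the neighbourhood. -/
theorem SchemeNode.notMem_closure_or_refines {d : ℕ → SchemeNode X Y} {i m : ℕ}
    (hi : (d i).Follows f F B i d) (hm : (d m).Follows f F B m d) :
    ((d i).point : Z) ∉ closure (d m).nhd ∨ m ≤ i ∧ ((d i).point : Z) ∈ (d m).nhd ∧
      (d i).piece ⊆ (d m).piece ∧ ∀ k < m, (d i).code k = (d m).code k := by
  rcases lt_trichotomy m i with h | rfl | h
  · rcases hi.disjoint_or_mem m h with h' | h'
    · exact Or.inl fun hx => disjoint_left.1 (h'.closure_right hi.isOpen_nhd) hi.point_mem_nhd hx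
    · exact Or.inr ⟨h.le, h'⟩
  · exact Or.inr ⟨le_rfl, hi.point_mem_nhd, Subset.rfl, fun _ _ => rfl⟩
  · exact Or.inl (hm.notMem_closure_nhd i h)

/-- Points near `z` lie on the same side as `z` of finitely many open sets. -/
theorem setOf_sameSide_mem_nhds {t : ℕ} {O : ℕ → Set Z} (hO : ∀ m < t, IsOpen (O m)) (z : Z) :
    {w | ∀ m < t, (z ∈ O m → w ∈ O m) ∧ (z ∉ closure (O m) → w ∉ closure (O m))} ∈ 𝓝 z := by
  refine (Filter.eventually_all_finite (finite_lt_nat t)).2 fun m hm => ?_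
  refine Filter.Eventually.and ?_ ?_
  · by_cases hz : z ∈ O m
    · filter_upwards [(hO m hm).mem_nhds hz] with w hw _ using hw
    · exact Filter.Eventually.of_forall fun w h => absurd h hz
  · by_cases hz : z ∈ closure (O m)
    · exact Filter.Eventually.of_forall fun w h => absurd hz h
    · filter_upwards [isClosed_closure.isOpen_compl.mem_nhds hz] with w hw _ using hw

/-- A set outside `I_f` in which the node of index `t` may be looked for. -/
theorem SchemeNode.exists_piece [RegularSpace Z] (hf : Sigma02Measurable f)
    (hnpc : ¬ MemIf f univ) (hX : ∀ x : X, (x : Z) ∈ souslinPart F 0 0)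
    (hB : ∀ x k, B x k ∈ 𝓝 x) {t : ℕ} {d : ℕ → SchemeNode X Y}
    (hd : ∀ i < t, (d i).Follows f F B i d) :
    (∀ i < t, IrredOutside f (d i).point (d i).piece (⋃ j < t, (d j).value)) ∧
    ∃ S : Set X, ¬ MemIf f S ∧ closure S ⊆ Af f (⋃ j < t, (d j).value) ∧
      (0 < t → closure S ⊆ B (d (parent t)).point t) ∧
      ∃ c, S ⊆ Subtype.val ⁻¹' souslinPart F t c ∧
        ∀ m < t, (∀ x ∈ closure S, (x : Z) ∉ closure (d m).nhd) ∨
          (∀ x ∈ closure S, (x : Z) ∈ (d m).nhd) ∧ S ⊆ (d m).piece ∧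
            ∀ k < m, c k = (d m).code k := by
  cases t with
  | zero =>
    refine ⟨by simp, univ, hnpc, by simp [Af], by simp, 0, fun x _ => hX x, by simp⟩
  | succ s =>
    have hirr : ∀ i < s + 1,
        IrredOutside f (d i).point (d i).piece (⋃ j < s + 1, (d j).value) := fun i hi => by
      rw [biUnion_lt_succ]
      rcases Nat.lt_succ_iff_lt_or_eq.1 hi with h | rfl
      · exact (hd s s.lt_succ_self).irred i h
      · exact (hd i hi).irred_self
    refine ⟨hirr, ?_⟩
    set t := s + 1
    have hi : parent t < t := parent_lt s.succ_pos
    set i := parent t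
    obtain ⟨V, hVo, hxV, hV⟩ := exists_isOpen_mem_closure_subset
      (setOf_sameSide_mem_nhds (O := fun m => (d m).nhd) (fun m hm => (hd m hm).isOpen_nhd)
        ((d i).point : Z))
    obtain ⟨W, hWo, hxW, hW⟩ := exists_isOpen_mem_closure_subset (hB (d i).point t)
    have hirr' := hirr i hi (Subtype.val ⁻¹' V ∩ W)
      ((hVo.preimage continuous_subtype_val).inter hWo) ⟨hxV, hxW⟩
    rw [inter_assoc] at hirr'
    obtain ⟨T, hTS, hT, hTA⟩ := exists_closure_subset_Af hf hirr'
    obtain ⟨S, hST, hS, c, hc, hSc⟩ := exists_subset_souslinPart F Subtype.val hi.le hT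
      ((hTS.trans inter_subset_left).trans (hd i hi).piece_subset)
    have hSV : ∀ x ∈ closure S, (x : Z) ∈ closure V := fun x hx =>
      continuous_subtype_val.closure_preimage_subset V
        (closure_mono ((hST.trans hTS).trans fun y hy => hy.2.1) hx)
    refine ⟨S, hS, (closure_mono hST).trans hTA, fun _ =>
      (closure_mono ((hST.trans hTS).trans fun y hy => hy.2.2)).trans hW, c, hSc, fun m hm => ?_⟩
    rcases notMem_closure_or_refines (hd i hi) (hd m hm) with h | ⟨hmi, hm1, hm2, hm3⟩
    · exact Or.inl fun x hx => (hV (hSV x hx) m hm).2 h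
    · exact Or.inr ⟨fun x hx => (hV (hSV x hx) m hm).1 hm1,
        ((hST.trans hTS).trans inter_subset_left).trans hm2,
        fun k hk => (hc k (hk.trans_le hmi)).trans (hm3 k hk)⟩

theorem SchemeNode.exists_follows [RegularSpace Z] [RegularSpace Y] [ParacompactSpace X]
    (hGδ : ∀ s : Set X, IsClosed s → IsGδ s) (hf : Sigma02Measurable f)
    (hnpc : ¬ MemIf f univ) (hX : ∀ x : X, (x : Z) ∈ souslinPart F 0 0)
    (hB : ∀ x k, B x k ∈ 𝓝 x) (t : ℕ) (d : ℕ → SchemeNode X Y)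
    (hd : ∀ i < t, (d i).Follows f F B i d) :
    ∃ n : SchemeNode X Y, n.Follows f F B t d := by
  obtain ⟨hirr, S, hS, hSA, hSB, c, hSc, hSd⟩ := exists_piece hf hnpc hX hB hd
  obtain ⟨T, hTS, x, hxT, U, hU, hxU, -, hxirr, hirr'⟩ :=
    exists_irredOutside_union hGδ hf (Finset.range t) (fun i => (d i).point)
      (fun i => (d i).piece) _ (fun i hi => hirr i (Finset.mem_range.1 hi)) _ S hS hSA
  have hTS' : closure T ⊆ closure S := closure_mono hTS
  have hxd : ∀ m < t, (x : Z) ∉ closure {((d m).point : Z)} := fun m hm hx => by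
    have hsp : x ⤳ (d m).point :=
      (Topology.IsInducing.subtypeVal.specializes_iff.1 (specializes_iff_mem_closure.2 hx)).symm
    exact notMem_Af (mem_iUnion₂.2 ⟨m, hm, (hd m hm).map_mem_value⟩)
      (hSA (hTS' (hsp.mem_closed isClosed_closure hxT)))
  obtain ⟨O, hO, hxO, hOsub⟩ := exists_isOpen_mem_closure_subset (Filter.inter_mem
    (setOf_sameSide_mem_nhds (O := fun m => (d m).nhd) (fun m hm => (hd m hm).isOpen_nhd) (x : Z))
    ((Filter.biInter_mem (finite_lt_nat t)).2 fun m hm =>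
      (isClosed_closure (s := {((d m).point : Z)})).isOpen_compl.mem_nhds (hxd m hm)))
  refine ⟨⟨x, T, U, O, c⟩, hU, hxU, hO, hxO, hxT, hTS.trans hSc, hTS'.trans hSA, fun m hm hmO => ?_,
    fun m hm => ?_, fun i hi => hirr' i (Finset.mem_range.2 hi),
    hxirr.union_left (subset_closure.trans (hTS'.trans hSA)), fun ht => hSB ht (hTS' hxT)⟩
  · exact mem_iInter₂.1 (hOsub hmO).2 m hm (subset_closure rfl)
  · rcases hSd m hm with h | ⟨h1, h2, h3⟩
    · exact Or.inl (disjoint_left.2 fun z hz hz' =>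
        ((hOsub (subset_closure hz)).1 m hm).2 (h x (hTS' hxT)) (subset_closure hz'))
    · exact Or.inr ⟨h1 x (hTS' hxT), hTS.trans h2, h3⟩

/-- A limit of the points of the scheme which lies in infinitely many of its neighbourhoods is
a point of the Souslin set whose image avoids all the values. -/
theorem SchemeNode.exists_eq_and_forall_notMem_value (hF : ∀ s, IsClosed (F s))
    (hX : X = ⋃ α : ℕ → ℕ, ⋂ n : ℕ, F ((List.range n).map α)) {d : ℕ → SchemeNode X Y}
    (hd : ∀ t, (d t).Follows f F B t d) {z : Z} (hz : z ∈ closure (range fun i => ((d i).point : Z)))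
    (hinf : ∀ k, ∃ m, k ≤ m ∧ z ∈ (d m).nhd) :
    ∃ x : X, (x : Z) = z ∧ ∀ j, f x ∉ (d j).value := by
  have hzcl : ∀ m, z ∈ (d m).nhd → z ∈ closure (Subtype.val '' (d m).piece) := fun m hm => by
    refine mem_closure_iff.2 fun O hO hzO => ?_
    obtain ⟨_, ⟨hiO, him⟩, i, rfl⟩ :=
      mem_closure_iff.1 hz _ (hO.inter (hd m).isOpen_nhd) ⟨hzO, hm⟩
    rcases notMem_closure_or_refines (hd i) (hd m) with h | ⟨-, -, hsub, -⟩
    · exact absurd (subset_closure him) h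
    · obtain ⟨y, hyO, hy⟩ := mem_closure_iff.1 (hd i).point_mem_closure _
        (hO.preimage continuous_subtype_val) hiO
      exact ⟨y, hyO, y, hsub hy, rfl⟩
  have hcode : ∀ m m', m ≤ m' → z ∈ (d m).nhd → z ∈ (d m').nhd →
      ∀ k < m, (d m').code k = (d m).code k := fun m m' hmm' hm hm' => by
    rcases hmm'.lt_or_eq with h | rfl
    · rcases (hd m').disjoint_or_mem m h with h' | h'
      · exact absurd hm (disjoint_left.1 h' hm')
      · exact h'.2.2
    · exact fun _ _ => rfl
  choose e hke hze using hinf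
  have hzF : ∀ m j, j ≤ m → z ∈ (d m).nhd → z ∈ F ((List.range j).map (d m).code) :=
    fun m j hj hm => by
      refine closure_minimal ?_ (hF _) (hzcl m hm)
      rintro _ ⟨y, hy, rfl⟩
      exact souslinPart_subset F hj _ ((hd m).piece_subset hy)
  have hzX : z ∈ X := by
    rw [hX]
    refine mem_iUnion.2 ⟨fun k => (d (e (k + 1))).code k, mem_iInter.2 fun j => ?_⟩
    rw [map_range_congr (α := (d (e j)).code) fun k hk => ?_]
    · exact hzF _ j (hke j) (hze j)
    · rcases le_total (e (k + 1)) (e j) with h | h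
      · exact (hcode _ _ h (hze _) (hze _) k (hke (k + 1))).symm
      · exact hcode _ _ h (hze _) (hze _) k (hk.trans_le (hke j))
  refine ⟨⟨z, hzX⟩, rfl, fun j hj => ?_⟩
  have hcl : (⟨z, hzX⟩ : X) ∈ closure (d (e (j + 1))).piece :=
    closure_subtype.2 (hzcl _ (hze _))
  exact notMem_Af (mem_iUnion₂.2 ⟨j, hke (j + 1), hj⟩) ((hd (e (j + 1))).closure_piece_subset hcl)

/-- Every point of the scheme is a limit of points of the scheme of arbitrarily large index. -/
theorem SchemeNode.point_mem_closure_tail (hB : ∀ x, (𝓝 x).HasAntitoneBasis (B x))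
    {d : ℕ → SchemeNode X Y} (hd : ∀ t, (d t).Follows f F B t d) (i k : ℕ) :
    (d i).point ∈ closure {x | ∃ m, k ≤ m ∧ x = (d m).point} := by
  refine mem_closure_iff_nhds.2 fun V hV => ?_
  obtain ⟨l, hl⟩ := (hB (d i).point).mem_iff.1 hV
  have h := (hd (Nat.pair i (max k l) + 1)).mem_basis (Nat.succ_pos _)
  have hle : max k l ≤ Nat.pair i (max k l) + 1 := (Nat.right_le_pair _ _).trans (Nat.le_succ _)
  rw [parent_pair_succ] at h
  exact ⟨_, hl ((hB _).antitone ((le_max_right k l).trans hle) h), _,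
    (le_max_left k l).trans hle, rfl⟩

end Scheme

/-- Under the hypotheses of the main theorem, a Σ⁰₂-measurable map which is not
piecewise continuous is not Δ⁰₂-measurable: some open set has a preimage that
is not simultaneously Fσ and Gδ. -/
theorem statement13 {Z Y : Type*} [TopologicalSpace Z] [RegularSpace Z]
    [TopologicalSpace Y] [RegularSpace Y]
    (hZ : CompletelyBaire Z) (X : Set Z) (hX : SouslinF X)
    [ParacompactSpace X] [FirstCountableTopology X]
    (hGdelta : ∀ s : Set X, IsClosed s → IsGδ s)
    (f : X → Y) (hf : Sigma02Measurable f) (hnpc : ¬ PiecewiseContinuous f) :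
    ∃ U : Set Y, IsOpen U ∧ ¬ (IsFsigma (f ⁻¹' U) ∧ IsGδ (f ⁻¹' U)) := by
  obtain ⟨F, hF, hXF⟩ := hX
  have hX0 : ∀ x : X, (x : Z) ∈ souslinPart F 0 0 := fun x => by
    obtain ⟨β, hβ⟩ := mem_iUnion.1 (hXF.subset x.2)
    exact ⟨β, by simp, mem_iInter.1 hβ⟩
  choose B hB using fun x : X => (𝓝 x).exists_antitone_basis
  have hne : Nonempty X := by
    by_contra h
    rw [not_nonempty_iff] at h
    exact not_memIf_univ hnpc (memIf_empty.mono fun x => isEmptyElim x)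
  have : Nonempty (SchemeNode X Y) := hne.map fun x => ⟨x, ∅, ∅, ∅, 0⟩
  obtain ⟨d, hd⟩ := exists_seq_of_forall_lt
    (fun t d (n : SchemeNode X Y) => n.Follows f F B t d) (fun _ _ _ _ h hn => hn.congr h)
    (SchemeNode.exists_follows hGdelta hf (not_memIf_univ hnpc) hX0 fun x k => (hB x).mem k)
  refine ⟨⋃ j, (d j).value, isOpen_iUnion fun j => (hd j).isOpen_value, fun ⟨_, hG⟩ => ?_⟩
  obtain ⟨G, hGo, hG⟩ := isGδ_iff_eq_iInter_nat.1 hG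
  choose O hO hOG using fun n => isOpen_induced_iff.1 (hGo n)
  set C : Set Z := closure (range fun i => ((d i).point : Z))
  have := hZ C isClosed_closure
  let p : ℕ → C := fun i => ⟨(d i).point, subset_closure (mem_range_self i)⟩
  have hp : DenseRange p := fun c => by
    rw [closure_subtype, ← range_comp]
    exact c.2
  let W : ℕ → Set C := fun k => Subtype.val ⁻¹' (O k ∩ ⋃ m ≥ k, (d m).nhd)
  have hWo : ∀ k, IsOpen (W k) := fun k => ((hO k).inter (isOpen_biUnion fun m _ =>
    (hd m).isOpen_nhd)).preimage continuous_subtype_val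
  have hWd : ∀ k, Dense (W k) := fun k => by
    refine dense_closure.1 (hp.mono ?_)
    rintro _ ⟨i, rfl⟩
    have hi := mem_closure_iff.1 (SchemeNode.point_mem_closure_tail hB hd i k)
    refine mem_closure_iff.2 fun V hV hiV => ?_
    obtain ⟨V', hV', rfl⟩ := isOpen_induced_iff.1 hV
    obtain ⟨_, hxV, m, hkm, rfl⟩ := hi _ (hV'.preimage continuous_subtype_val) hiV
    refine ⟨p m, hxV, ?_, mem_iUnion₂.2 ⟨m, hkm, (hd m).point_mem_nhd⟩⟩
    have hm : (d m).point ∈ f ⁻¹' ⋃ j, (d j).value := mem_iUnion.2 ⟨m, (hd m).map_mem_value⟩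
    rw [hG] at hm
    have := mem_iInter.1 hm k
    rwa [← hOG k] at this
  have : Nonempty C := ⟨p 0⟩
  obtain ⟨z, hz⟩ := (dense_iInter_of_isOpen hWo hWd).nonempty
  obtain ⟨x, hxz, hx⟩ := SchemeNode.exists_eq_and_forall_notMem_value hF hXF hd z.2 fun k => by
    obtain ⟨m, hkm, hm⟩ := mem_iUnion₂.1 (mem_iInter.1 hz k).2
    exact ⟨m, hkm, hm⟩
  have hxU : x ∈ f ⁻¹' ⋃ j, (d j).value := by
    rw [hG]
    refine mem_iInter.2 fun k => ?_
    rw [← hOG k, mem_preimage, hxz]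
    exact (mem_iInter.1 hz k).1
  obtain ⟨j, hj⟩ := mem_iUnion.1 hxU
  exact hx j hj
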